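/- n-letter converse step for inequality (2a) of Theorem 2. Let (X_{1i},X_{2i},W_i), i=1,…,n, be i.i.d. with pmf q_{X1X2W}; let K1,K2,Θ1,Θ2 be mutually independent and independent of (X1^n,X2^n,W^n); let X̃1^n be a deterministic function of (K1,X1^n,Θ1) and X̃2^n a deterministic function of (K2,X2^n,Θ2); and let Ỹ^n be the output of a memoryless channel p(ỹ|x̃1,x̃2) applied componentwise to (X̃1^n,X̃2^n), with Ỹ^n – (X̃1^n,X̃2^n) – (K1,K2,X1^n,X2^n,W^n,Θ1,Θ2) a Markov chain. Define U_{1i} = (K1, X_{1,i+1}^n, Ỹ^n, W_{∼i}) and U_{2i} = (K2, X_{2,i+1}^n). Then ∑_{i=1}^n I(X̃_{1i}; Ỹ_i | X̃_{2i}) ≥ I(X1^n; Ỹ^n | K1,K2,X2^n,W^n,Θ1,Θ2) ≥ ∑_{i=1}^n I(U_{1i}; X_{1i} | U_{2i}, X_{2i}, W_i). -/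

import Mathlib

open scoped BigOperators

namespace SecCoord

/-- `p` is a probability mass function on the finite type `α`. -/
def IsPMF {α : Type*} [Fintype α] (p : α → ℝ) : Prop :=
  (∀ a, 0 ≤ p a) ∧ ∑ a, p a = 1

/-- Total variation distance between two pmfs: half the `ℓ¹`-distance. -/
noncomputable def TV {α : Type*} [Fintype α] (p q : α → ℝ) : ℝ :=
  (1 / 2) * ∑ a, |p a - q a|

/-- Distribution (pushforward pmf) of a random variable `X : Ω → α` under `μ`. -/
noncomputable def dist {Ω α : Type*} [Fintype Ω] (μ : Ω → ℝ) (X : Ω → α) : α → ℝ :=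
  fun a => ∑ ω, Set.indicator {ω' | X ω' = a} μ ω

/-- Shannon entropy (in bits) of the random variable `X` under `μ`. -/
noncomputable def H {Ω α : Type*} [Fintype Ω] [Fintype α] (μ : Ω → ℝ) (X : Ω → α) : ℝ :=
  -∑ a, dist μ X a * Real.logb 2 (dist μ X a)

/-- Conditional Shannon entropy `H(X | Z)` (in bits). -/
noncomputable def condEnt {Ω α β : Type*} [Fintype Ω] [Fintype α] [Fintype β]
    (μ : Ω → ℝ) (X : Ω → α) (Z : Ω → β) : ℝ :=
  H μ (fun ω => (X ω, Z ω)) - H μ Z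

/-- Mutual information `I(X; Y)` (in bits). -/
noncomputable def MI {Ω α β : Type*} [Fintype Ω] [Fintype α] [Fintype β]
    (μ : Ω → ℝ) (X : Ω → α) (Y : Ω → β) : ℝ :=
  H μ X + H μ Y - H μ (fun ω => (X ω, Y ω))

/-- Conditional mutual information `I(X; Y | Z)` (in bits). -/
noncomputable def CMI {Ω α β γ : Type*} [Fintype Ω] [Fintype α] [Fintype β] [Fintype γ]
    (μ : Ω → ℝ) (X : Ω → α) (Y : Ω → β) (Z : Ω → γ) : ℝ :=
  (H μ (fun ω => (X ω, Z ω))) + (H μ (fun ω => (Y ω, Z ω)))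
    - (H μ (fun ω => (X ω, Y ω, Z ω))) - H μ Z

section Helpers

open Classical in
theorem dist_eq_ite {Ω α : Type*} [Fintype Ω] (μ : Ω → ℝ) (X : Ω → α) (a : α) :
    dist μ X a = ∑ ω, if X ω = a then μ ω else 0 := by
  unfold dist
  refine Finset.sum_congr rfl fun ω _ => ?_
  by_cases h : X ω = a <;> simp [Set.indicator, h]

theorem dist_nonneg' {Ω α : Type*} [Fintype Ω] {μ : Ω → ℝ} (h0 : ∀ ω, 0 ≤ μ ω) (X : Ω → α)
    (a : α) : 0 ≤ dist μ X a := by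
  classical
  rw [dist_eq_ite]
  refine Finset.sum_nonneg fun ω _ => ?_
  split_ifs
  · exact h0 ω
  · exact le_rfl

theorem dist_pos' {Ω α : Type*} [Fintype Ω] {μ : Ω → ℝ} (h0 : ∀ ω, 0 ≤ μ ω) (X : Ω → α)
    (ω : Ω) (h : μ ω ≠ 0) : 0 < dist μ X (X ω) := by
  classical
  have hp : 0 < μ ω := lt_of_le_of_ne (h0 ω) (Ne.symm h)
  rw [dist_eq_ite]
  refine lt_of_lt_of_le hp ?_
  have := Finset.single_le_sum (f := fun ω' => if X ω' = X ω then μ ω' else 0)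
    (s := Finset.univ) (fun ω' _ => by
      split_ifs
      · exact h0 ω'
      · exact le_rfl) (Finset.mem_univ ω)
  simpa using this

/-- change of variables -/
theorem sum_dist_mul {Ω α : Type*} [Fintype Ω] [Fintype α] (μ : Ω → ℝ) (X : Ω → α)
    (g : α → ℝ) : ∑ a, dist μ X a * g a = ∑ ω, μ ω * g (X ω) := by
  classical
  simp_rw [dist_eq_ite, Finset.sum_mul]
  rw [Finset.sum_comm]
  refine Finset.sum_congr rfl fun ω _ => ?_
  simp [ite_mul]

theorem H_eq {Ω α : Type*} [Fintype Ω] [Fintype α] (μ : Ω → ℝ) (X : Ω → α) :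
    H μ X = -∑ ω, μ ω * Real.logb 2 (dist μ X (X ω)) := by
  unfold H
  rw [sum_dist_mul μ X (fun a => Real.logb 2 (dist μ X a))]

theorem H_congr {Ω α β : Type*} [Fintype Ω] [Fintype α] [Fintype β] (μ : Ω → ℝ)
    (X : Ω → α) (Y : Ω → β) (h : ∀ ω ω', X ω = X ω' ↔ Y ω = Y ω') : H μ X = H μ Y := by
  classical
  rw [H_eq, H_eq]
  congr 1
  refine Finset.sum_congr rfl fun ω _ => ?_
  congr 2
  rw [dist_eq_ite, dist_eq_ite]
  refine Finset.sum_congr rfl fun ω' _ => ?_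
  simp only [h]

open Classical in
theorem dist_comp {Ω α β : Type*} [Fintype Ω] [Fintype α] (μ : Ω → ℝ)
    (X : Ω → α) (g : α → β) (b : β) :
    dist μ (fun ω => g (X ω)) b = ∑ a, if g a = b then dist μ X a else 0 := by
  have := sum_dist_mul μ X (fun a => if g a = b then (1 : ℝ) else 0)
  simp only [mul_ite, mul_one, mul_zero] at this
  rw [this, dist_eq_ite]

theorem dist_snd {Ω α β : Type*} [Fintype Ω] [Fintype α] [Fintype β] (μ : Ω → ℝ)
    (X : Ω → α) (Z : Ω → β) (b : β) :
    ∑ a, dist μ (fun ω => (X ω, Z ω)) (a, b) = dist μ Z b := by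
  classical
  rw [dist_comp μ (fun ω => (X ω, Z ω)) Prod.snd b, Fintype.sum_prod_type]
  simp

theorem dist_equiv {Ω α β : Type*} [Fintype Ω] [Fintype α] [Fintype β] (μ : Ω → ℝ)
    (φ : Ω ≃ α × β) (a : α) :
    dist μ (fun ω => (φ ω).1) a = ∑ b, μ (φ.symm (a, b)) := by
  classical
  rw [dist_eq_ite, ← Equiv.sum_comp φ.symm, Fintype.sum_prod_type]
  simp only [Equiv.apply_symm_apply]
  rw [Finset.sum_eq_single a]
  · simp
  · intro b _ hb
    simp [hb]
  · simp

theorem submod {Ω α β γ : Type*} [Fintype Ω] [Fintype α] [Fintype β] [Fintype γ]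
    {μ : Ω → ℝ} (h0 : ∀ ω, 0 ≤ μ ω) (X : Ω → α) (Y : Ω → β) (Z : Ω → γ) :
    H μ (fun ω => (X ω, Y ω, Z ω)) + H μ Z ≤
      H μ (fun ω => (X ω, Z ω)) + H μ (fun ω => (Y ω, Z ω)) := by
  classical
  set dXYZ := dist μ (fun ω => (X ω, Y ω, Z ω)) with hXYZ
  set dXZ := dist μ (fun ω => (X ω, Z ω)) with hXZ
  set dYZ := dist μ (fun ω => (Y ω, Z ω)) with hYZ
  set dZ := dist μ Z with hZ
  have nXYZ : ∀ a, 0 ≤ dXYZ a := dist_nonneg' h0 _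
  have nXZ : ∀ a, 0 ≤ dXZ a := dist_nonneg' h0 _
  have nYZ : ∀ a, 0 ≤ dYZ a := dist_nonneg' h0 _
  have nZ : ∀ a, 0 ≤ dZ a := dist_nonneg' h0 _
  have hl2 : 0 < Real.log 2 := Real.log_pos (by norm_num)
  -- total
  have htot : ∑ c, dZ c = ∑ ω, μ ω := by
    have := sum_dist_mul μ Z (fun _ => (1 : ℝ))
    simpa using this
  have hbound : ∑ ω, μ ω * (dXZ (X ω, Z ω) * dYZ (Y ω, Z ω) /
      (dXYZ (X ω, Y ω, Z ω) * dZ (Z ω))) ≤ ∑ ω, μ ω := by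
    rw [← sum_dist_mul μ (fun ω => (X ω, Y ω, Z ω))
      (fun t => dXZ (t.1, t.2.2) * dYZ (t.2.1, t.2.2) / (dXYZ t * dZ t.2.2)), ← htot]
    calc _ ≤ ∑ t : α × β × γ, dXZ (t.1, t.2.2) * dYZ (t.2.1, t.2.2) / dZ t.2.2 := by
          refine Finset.sum_le_sum fun t _ => ?_
          change dXYZ t * _ ≤ _
          rcases eq_or_ne (dXYZ t) 0 with h | h
          · rw [h, zero_mul]
            exact div_nonneg (mul_nonneg (nXZ _) (nYZ _)) (nZ _)
          · apply le_of_eq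
            rw [mul_div_assoc', mul_div_mul_left _ _ h]
      _ = ∑ c, (∑ a, dXZ (a, c)) * (∑ b, dYZ (b, c)) / dZ c := by
          simp_rw [Fintype.sum_prod_type]
          rw [Finset.sum_congr rfl (fun a _ => Finset.sum_comm), Finset.sum_comm]
          refine Finset.sum_congr rfl fun c _ => ?_
          simp_rw [Finset.sum_mul_sum, Finset.sum_div]
      _ = ∑ c, dZ c := by
          refine Finset.sum_congr rfl fun c _ => ?_
          rw [hXZ, hYZ, dist_snd, dist_snd, ← hZ]
          rcases eq_or_ne (dZ c) 0 with h | h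
          · simp [h]
          · field_simp
  have key : ∑ ω, μ ω * (Real.log (dXZ (X ω, Z ω)) + Real.log (dYZ (Y ω, Z ω))
      - Real.log (dXYZ (X ω, Y ω, Z ω)) - Real.log (dZ (Z ω))) ≤ 0 := by
    calc _ ≤ ∑ ω, (μ ω * (dXZ (X ω, Z ω) * dYZ (Y ω, Z ω) /
      (dXYZ (X ω, Y ω, Z ω) * dZ (Z ω))) - μ ω) := by
          refine Finset.sum_le_sum fun ω _ => ?_
          rcases eq_or_ne (μ ω) 0 with h | h
          · simp [h]
          · have p1 : 0 < dXZ (X ω, Z ω) := dist_pos' h0 (fun ω => (X ω, Z ω)) ω h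
            have p2 : 0 < dYZ (Y ω, Z ω) := dist_pos' h0 (fun ω => (Y ω, Z ω)) ω h
            have p3 : 0 < dXYZ (X ω, Y ω, Z ω) :=
              dist_pos' h0 (fun ω => (X ω, Y ω, Z ω)) ω h
            have p4 : 0 < dZ (Z ω) := dist_pos' h0 Z ω h
            have := Real.log_le_sub_one_of_pos (div_pos (mul_pos p1 p2) (mul_pos p3 p4))
            rw [Real.log_div (mul_pos p1 p2).ne' (mul_pos p3 p4).ne',
              Real.log_mul p1.ne' p2.ne', Real.log_mul p3.ne' p4.ne'] at this
            have h2 := mul_le_mul_of_nonneg_left this (h0 ω)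
            linarith
      _ ≤ 0 := by
          rw [Finset.sum_sub_distrib]
          linarith
  rw [H_eq, H_eq, H_eq, H_eq]
  have key2 : ∑ ω, μ ω * (Real.logb 2 (dXZ (X ω, Z ω)) + Real.logb 2 (dYZ (Y ω, Z ω))
      - Real.logb 2 (dXYZ (X ω, Y ω, Z ω)) - Real.logb 2 (dZ (Z ω))) ≤ 0 := by
    have : ∑ ω, μ ω * (Real.logb 2 (dXZ (X ω, Z ω)) + Real.logb 2 (dYZ (Y ω, Z ω))
      - Real.logb 2 (dXYZ (X ω, Y ω, Z ω)) - Real.logb 2 (dZ (Z ω))) =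
      (∑ ω, μ ω * (Real.log (dXZ (X ω, Z ω)) + Real.log (dYZ (Y ω, Z ω))
      - Real.log (dXYZ (X ω, Y ω, Z ω)) - Real.log (dZ (Z ω)))) / Real.log 2 := by
      rw [Finset.sum_div]
      refine Finset.sum_congr rfl fun ω _ => ?_
      simp only [Real.logb]
      ring
    rw [this]
    exact div_nonpos_of_nonpos_of_nonneg key hl2.le
  simp only [mul_sub, mul_add, Finset.sum_sub_distrib, Finset.sum_add_distrib] at key2
  linarith

theorem cond_mono {Ω α β γ : Type*} [Fintype Ω] [Fintype α] [Fintype β] [Fintype γ]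
    {μ : Ω → ℝ} (h0 : ∀ ω, 0 ≤ μ ω) (T : Ω → α) (V : Ω → β) (V' : Ω → γ)
    (h : ∀ ω ω', V ω = V ω' → V' ω = V' ω') :
    H μ (fun ω => (T ω, V ω)) - H μ V ≤ H μ (fun ω => (T ω, V' ω)) - H μ V' := by
  have h1 := submod h0 T V V'
  have h2 : H μ (fun ω => (T ω, V ω, V' ω)) = H μ (fun ω => (T ω, V ω)) := by
    apply H_congr
    intro ω ω'
    simp only [Prod.mk.injEq]
    have := h ω ω'
    tauto
  have h3 : H μ (fun ω => (V ω, V' ω)) = H μ V := by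
    apply H_congr
    intro ω ω'
    simp only [Prod.mk.injEq]
    have := h ω ω'
    tauto
  linarith

theorem chain {Ω α β : Type*} [Fintype Ω] [Fintype α] [Fintype β] {n : ℕ}
    (μ : Ω → ℝ) (T : Ω → Fin n → α) (B : Ω → β) :
    H μ (fun ω => (T ω, B ω)) - H μ B =
      ∑ i : Fin n, (H μ (fun ω => (T ω i, (fun j : {j : Fin n // i < j} => T ω j.1), B ω)) -
        H μ (fun ω => ((fun j : {j : Fin n // i < j} => T ω j.1), B ω))) := by
  let h : ℕ → ℝ := fun k => H μ (fun ω => ((fun j : {j : Fin n // k ≤ j.1} => T ω j.1), B ω))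
  have e0 : H μ (fun ω => (T ω, B ω)) = h 0 := by
    apply H_congr
    intro ω ω'
    simp [funext_iff]
  have en : H μ B = h n := by
    apply H_congr
    intro ω ω'
    simp only [Prod.mk.injEq, funext_iff, Subtype.forall]
    constructor
    · intro hb
      exact ⟨fun a ha => absurd a.2 (by omega), hb⟩
    · exact fun hb => hb.2
  have ei : ∀ i : Fin n, H μ (fun ω => (T ω i, (fun j : {j : Fin n // i < j} => T ω j.1), B ω))
      - H μ (fun ω => ((fun j : {j : Fin n // i < j} => T ω j.1), B ω)) = h i - h (i + 1) := by
    intro i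
    congr 1
    · apply H_congr
      intro ω ω'
      simp only [Prod.mk.injEq, funext_iff, Subtype.forall]
      constructor
      · rintro ⟨h1, h2, h3⟩
        refine ⟨fun a ha => ?_, h3⟩
        rcases Nat.lt_or_ge i.1 a.1 with hlt | hge
        · exact h2 a hlt
        · have : a = i := Fin.ext (by omega)
          rw [this]; exact h1
      · rintro ⟨h1, h3⟩
        exact ⟨h1 i le_rfl, fun a ha => h1 a (le_of_lt ha), h3⟩
  rw [e0, en, Finset.sum_congr rfl (fun i _ => ei i),
    Fin.sum_univ_eq_sum_range (fun k => h k - h (k + 1)) n, Finset.sum_range_sub']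

theorem sum_prod_eq_one {α : Type*} [Fintype α] {n : ℕ} (c : Fin n → α → ℝ)
    (hc : ∀ i, ∑ a, c i a = 1) : ∑ t : Fin n → α, ∏ i, c i (t i) = 1 := by
  rw [← Fintype.prod_sum]
  simp [hc]

open Classical in
theorem sum_prod_marg {α : Type*} [Fintype α] {n : ℕ} (c : Fin n → α → ℝ)
    (hc : ∀ i, ∑ a, c i a = 1) (i : Fin n) (y : α) :
    (∑ t : Fin n → α, if t i = y then ∏ j, c j (t j) else 0) = c i y := by
  have h := Fintype.prod_sum (fun (j : Fin n) (x : α) =>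
    if j = i then (if x = y then c j x else 0) else c j x)
  have hl : (∏ j : Fin n, ∑ x, if j = i then (if x = y then c j x else 0) else c j x) = c i y := by
    rw [Finset.prod_eq_single i]
    · simp
    · intro b _ hb
      simp [hb, hc]
    · simp
  rw [hl] at h
  rw [h]
  refine Finset.sum_congr rfl fun t _ => ?_
  split_ifs with hy
  · refine Finset.prod_congr rfl fun j _ => ?_
    by_cases hj : j = i
    · subst hj; simp [hy]
    · simp [hj]
  · symm
    apply Finset.prod_eq_zero (Finset.mem_univ i)
    simp [hy]

theorem memoryless {Ω α β σ : Type*} [Fintype Ω] [Fintype α] [Fintype β] [Fintype σ] {n : ℕ}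
    {μ : Ω → ℝ} (h0 : ∀ ω, 0 ≤ μ ω) (T : Ω → Fin n → α) (S : Ω → σ)
    (f : Fin n → σ → β) (m : σ → ℝ) (c : β → α → ℝ) (hc : ∀ b, ∑ a, c b a = 1)
    (hd : ∀ t s, dist μ (fun ω => (T ω, S ω)) (t, s) = m s * ∏ i, c (f i s) (t i)) :
    H μ (fun ω => (T ω, S ω)) - H μ S =
      ∑ i : Fin n, (H μ (fun ω => (T ω i, f i (S ω))) - H μ (fun ω => f i (S ω))) := by
  classical
  have hS : ∀ s, dist μ S s = m s := by
    intro s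
    rw [← dist_snd μ T S s]
    simp_rw [hd, ← Finset.mul_sum]
    rw [sum_prod_eq_one _ (fun i => hc _), mul_one]
  have hi : ∀ i y b, dist μ (fun ω => (T ω i, f i (S ω))) (y, b) =
      dist μ (fun ω => f i (S ω)) b * c b y := by
    intro i y b
    rw [dist_comp μ S (f i) b,
      dist_comp μ (fun ω => (T ω, S ω)) (fun p => (p.1 i, f i p.2)) (y, b),
      Fintype.sum_prod_type, Finset.sum_comm, Finset.sum_mul]
    refine Finset.sum_congr rfl fun s _ => ?_
    by_cases hb : f i s = b
    · simp only [Prod.mk.injEq, hb, and_true, if_true, hd, hS]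
      have := sum_prod_marg (fun j => c (f j s)) (fun j => hc _) i y
      rw [← hb, ← this, Finset.mul_sum]
      refine Finset.sum_congr rfl fun t _ => ?_
      split_ifs <;> simp
    · simp [hb]
  simp_rw [H_eq]
  have e1 : ∀ i : Fin n, ((-∑ ω, μ ω * Real.logb 2 (dist μ (fun ω => (T ω i, f i (S ω)))
      (T ω i, f i (S ω)))) - (-∑ ω, μ ω * Real.logb 2 (dist μ (fun ω => f i (S ω)) (f i (S ω)))))
      = -∑ ω, μ ω * Real.logb 2 (c (f i (S ω)) (T ω i)) := by
    intro i
    rw [← neg_eq_iff_eq_neg]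
    rw [neg_sub, neg_sub_neg, ← Finset.sum_sub_distrib]
    refine Finset.sum_congr rfl fun ω _ => ?_
    rcases eq_or_ne (μ ω) 0 with h | h
    · simp [h]
    · have p1 := (dist_pos' h0 (fun ω => (T ω i, f i (S ω))) ω h).ne'
      rw [hi] at p1 ⊢
      rw [Real.logb_mul (left_ne_zero_of_mul p1) (right_ne_zero_of_mul p1)]
      ring
  rw [Finset.sum_congr rfl (fun i _ => e1 i), Finset.sum_neg_distrib, ← neg_eq_iff_eq_neg,
    neg_sub, neg_sub_neg, ← Finset.sum_sub_distrib, Finset.sum_comm]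
  refine Finset.sum_congr rfl fun ω _ => ?_
  rcases eq_or_ne (μ ω) 0 with h | h
  · simp [h]
  · have p1 := (dist_pos' h0 (fun ω => (T ω, S ω)) ω h).ne'
    rw [hd] at p1 ⊢
    rw [hS, Real.logb_mul (left_ne_zero_of_mul p1) (right_ne_zero_of_mul p1),
      Real.logb_prod _ _ (fun i _ => Finset.prod_ne_zero_iff.mp (right_ne_zero_of_mul p1) i
        (Finset.mem_univ i)), ← Finset.mul_sum]
    ring

end Helpers

section ConverseStep2a

variable {K1 K2 Th1 Th2 X1 X2 W Xt1 Xt2 Yt : Type}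
  [Fintype K1] [Fintype K2] [Fintype Th1] [Fintype Th2]
  [Fintype X1] [Fintype X2] [Fintype W] [Fintype Xt1] [Fintype Xt2] [Fintype Yt]

/-- **n-letter converse step for inequality (2a) of Theorem 2.**  With i.i.d. sources,
shared randomness and private randomness independent of them, deterministic encoders
`X̃1ⁿ = e1(K1, X1ⁿ, Θ1)`, `X̃2ⁿ = e2(K2, X2ⁿ, Θ2)`, and a memoryless channel used
componentwise, one has, for `U_{1i} = (K1, X_{1,i+1}ⁿ, Ỹⁿ, W_{∼i})` and
`U_{2i} = (K2, X_{2,i+1}ⁿ)`: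
`∑ᵢ I(X̃_{1i}; Ỹᵢ | X̃_{2i}) ≥ I(X1ⁿ; Ỹⁿ | K1,K2,X2ⁿ,Wⁿ,Θ1,Θ2)
  ≥ ∑ᵢ I(U_{1i}; X_{1i} | U_{2i}, X_{2i}, Wᵢ)`. -/
theorem converse_step_2a {n : ℕ}
    (pK1 : K1 → ℝ) (hpK1 : IsPMF pK1) (pK2 : K2 → ℝ) (hpK2 : IsPMF pK2)
    (pT1 : Th1 → ℝ) (hpT1 : IsPMF pT1) (pT2 : Th2 → ℝ) (hpT2 : IsPMF pT2)
    (qs : X1 × X2 × W → ℝ) (hqs : IsPMF qs)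
    (e1 : K1 → (Fin n → X1) → Th1 → (Fin n → Xt1))
    (e2 : K2 → (Fin n → X2) → Th2 → (Fin n → Xt2))
    (pch : Xt1 × Xt2 → Yt → ℝ) (hpch : ∀ x, IsPMF (pch x))
    (μ : K1 × K2 × Th1 × Th2 × (Fin n → X1) × (Fin n → X2) × (Fin n → W) ×
      (Fin n → Yt) → ℝ)
    (hμ : ∀ k1 k2 θ1 θ2 x1 x2 w yt,
      μ (k1, k2, θ1, θ2, x1, x2, w, yt) =
        pK1 k1 * pK2 k2 * pT1 θ1 * pT2 θ2 * (∏ i, qs (x1 i, x2 i, w i)) *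
          ∏ i, pch (e1 k1 x1 θ1 i, e2 k2 x2 θ2 i) (yt i)) :
    (∑ i : Fin n, CMI μ
        (fun ω => e1 ω.1 ω.2.2.2.2.1 ω.2.2.1 i)
        (fun ω => ω.2.2.2.2.2.2.2 i)
        (fun ω => e2 ω.2.1 ω.2.2.2.2.2.1 ω.2.2.2.1 i)) ≥
      CMI μ (fun ω => ω.2.2.2.2.1) (fun ω => ω.2.2.2.2.2.2.2)
        (fun ω => (ω.1, ω.2.1, ω.2.2.2.2.2.1, ω.2.2.2.2.2.2.1, ω.2.2.1, ω.2.2.2.1)) ∧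
    CMI μ (fun ω => ω.2.2.2.2.1) (fun ω => ω.2.2.2.2.2.2.2)
        (fun ω => (ω.1, ω.2.1, ω.2.2.2.2.2.1, ω.2.2.2.2.2.2.1, ω.2.2.1, ω.2.2.2.1)) ≥
      ∑ i : Fin n, CMI μ
        (fun ω => (ω.1, fun j : {j : Fin n // i < j} => ω.2.2.2.2.1 j.1,
          ω.2.2.2.2.2.2.2, fun j : {j : Fin n // j ≠ i} => ω.2.2.2.2.2.2.1 j.1))
        (fun ω => ω.2.2.2.2.1 i)
        (fun ω => ((ω.2.1, fun j : {j : Fin n // i < j} => ω.2.2.2.2.2.1 j.1),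
          ω.2.2.2.2.2.1 i, ω.2.2.2.2.2.2.1 i)) := by
  classical
  have h0 : ∀ ω, 0 ≤ μ ω := by
    rintro ⟨k1, k2, θ1, θ2, x1, x2, w, yt⟩
    rw [hμ]
    have := hpK1.1 k1
    have := hpK2.1 k2
    have := hpT1.1 θ1
    have := hpT2.1 θ2
    have h5 : 0 ≤ ∏ i, qs (x1 i, x2 i, w i) := Finset.prod_nonneg fun i _ => hqs.1 _
    have h6 : 0 ≤ ∏ i, pch (e1 k1 x1 θ1 i, e2 k2 x2 θ2 i) (yt i) :=
      Finset.prod_nonneg fun i _ => (hpch _).1 _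
    positivity
  constructor
  · -- first inequality
    have hm := memoryless h0 (fun ω => ω.2.2.2.2.2.2.2)
      (fun ω => (ω.2.2.2.2.1,
        (ω.1, ω.2.1, ω.2.2.2.2.2.1, ω.2.2.2.2.2.2.1, ω.2.2.1, ω.2.2.2.1)))
      (fun i s => (e1 s.2.1 s.1 s.2.2.2.2.2.1 i, e2 s.2.2.1 s.2.2.2.1 s.2.2.2.2.2.2 i))
      (fun s => pK1 s.2.1 * pK2 s.2.2.1 * pT1 s.2.2.2.2.2.1 * pT2 s.2.2.2.2.2.2 *
        (∏ i, qs (s.1 i, s.2.2.2.1 i, s.2.2.2.2.1 i)))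
      pch (fun b => (hpch b).2) (by
        intro t s
        have := dist_equiv (α := (Fin n → Yt) × (Fin n → X1) × K1 × K2 × (Fin n → X2) ×
            (Fin n → W) × Th1 × Th2) (β := Unit) μ
          ⟨fun ω => ((ω.2.2.2.2.2.2.2, (ω.2.2.2.2.1,
            (ω.1, ω.2.1, ω.2.2.2.2.2.1, ω.2.2.2.2.2.2.1, ω.2.2.1, ω.2.2.2.1))), ()),
           fun p => (p.1.2.2.1, p.1.2.2.2.1, p.1.2.2.2.2.2.2.1, p.1.2.2.2.2.2.2.2, p.1.2.1,
            p.1.2.2.2.2.1, p.1.2.2.2.2.2.1, p.1.1), fun _ => rfl, fun _ => rfl⟩ (t, s)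
        simp only [Finset.univ_unique, Finset.sum_singleton, Equiv.coe_fn_mk,
          Equiv.coe_fn_symm_mk] at this
        rw [this, hμ])
    have hch := chain μ (fun ω => ω.2.2.2.2.2.2.2)
      (fun ω => (ω.1, ω.2.1, ω.2.2.2.2.2.1, ω.2.2.2.2.2.2.1, ω.2.2.1, ω.2.2.2.1))
    have hle := Finset.sum_le_sum (s := Finset.univ) (fun (i : Fin n) _ =>
      cond_mono h0 (fun ω => ω.2.2.2.2.2.2.2 i)
      (fun ω => ((fun j : {j : Fin n // i < j} => ω.2.2.2.2.2.2.2 j.1),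
        (ω.1, ω.2.1, ω.2.2.2.2.2.1, ω.2.2.2.2.2.2.1, ω.2.2.1, ω.2.2.2.1)))
      (fun ω => e2 ω.2.1 ω.2.2.2.2.2.1 ω.2.2.2.1 i)
      (by
        intro ω ω' h
        simp only [Prod.mk.injEq] at h
        obtain ⟨-, -, h1, h2, -, -, h3⟩ := h
        rw [h1, h2, h3]))
    have ht : ∀ i : Fin n, CMI μ
        (fun ω => e1 ω.1 ω.2.2.2.2.1 ω.2.2.1 i)
        (fun ω => ω.2.2.2.2.2.2.2 i)
        (fun ω => e2 ω.2.1 ω.2.2.2.2.2.1 ω.2.2.2.1 i) =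
        (H μ (fun ω => (ω.2.2.2.2.2.2.2 i, e2 ω.2.1 ω.2.2.2.2.2.1 ω.2.2.2.1 i)) -
          H μ (fun ω => e2 ω.2.1 ω.2.2.2.2.2.1 ω.2.2.2.1 i)) -
        (H μ (fun ω => (ω.2.2.2.2.2.2.2 i, (e1 ω.1 ω.2.2.2.2.1 ω.2.2.1 i,
          e2 ω.2.1 ω.2.2.2.2.2.1 ω.2.2.2.1 i))) -
          H μ (fun ω => (e1 ω.1 ω.2.2.2.2.1 ω.2.2.1 i,
          e2 ω.2.1 ω.2.2.2.2.2.1 ω.2.2.2.1 i))) := by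
      intro i
      unfold CMI
      have : H μ (fun ω => (e1 ω.1 ω.2.2.2.2.1 ω.2.2.1 i, ω.2.2.2.2.2.2.2 i,
          e2 ω.2.1 ω.2.2.2.2.2.1 ω.2.2.2.1 i)) =
          H μ (fun ω => (ω.2.2.2.2.2.2.2 i, (e1 ω.1 ω.2.2.2.2.1 ω.2.2.1 i,
          e2 ω.2.1 ω.2.2.2.2.2.1 ω.2.2.2.1 i))) := by
        apply H_congr
        intro ω ω'
        simp only [Prod.mk.injEq]
        tauto
      linarith
    rw [Finset.sum_congr rfl (fun i _ => ht i), Finset.sum_sub_distrib]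
    have hc2 : H μ (fun ω => (ω.2.2.2.2.1, ω.2.2.2.2.2.2.2,
        (ω.1, ω.2.1, ω.2.2.2.2.2.1, ω.2.2.2.2.2.2.1, ω.2.2.1, ω.2.2.2.1))) =
        H μ (fun ω => (ω.2.2.2.2.2.2.2, (ω.2.2.2.2.1,
        (ω.1, ω.2.1, ω.2.2.2.2.2.1, ω.2.2.2.2.2.2.1, ω.2.2.1, ω.2.2.2.1)))) := by
      apply H_congr
      intro ω ω'
      simp only [Prod.mk.injEq]
      tauto
    unfold CMI
    dsimp only at hm hch hle hc2 ⊢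
    linarith
  · -- second inequality
    have hne : Nonempty (X1 × X2 × W) := by
      by_contra hcon
      rw [not_nonempty_iff] at hcon
      have := hqs.2
      simp at this
    obtain ⟨x0, -, -⟩ := hne
    let qr : X2 × W → ℝ := fun b => ∑ a, qs (a, b)
    let c : X2 × W → X1 → ℝ := fun b a =>
      if qr b = 0 then (if a = x0 then 1 else 0) else qs (a, b) / qr b
    have hc : ∀ b, ∑ a, c b a = 1 := by
      intro b
      by_cases hb : qr b = 0
      · simp [c, hb]
      · simp only [c, hb, if_false]
        rw [← Finset.sum_div]
        exact div_self hb
    have hqc : ∀ a b, qs (a, b) = qr b * c b a := by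
      intro a b
      by_cases hb : qr b = 0
      · rw [hb, zero_mul]
        exact (Finset.sum_eq_zero_iff_of_nonneg (fun a _ => hqs.1 (a, b))).mp hb a
          (Finset.mem_univ a)
      · simp only [c, hb, if_false]
        field_simp
    have hm := memoryless h0 (fun ω => ω.2.2.2.2.1)
      (fun ω => (ω.1, ω.2.1, ω.2.2.2.2.2.1, ω.2.2.2.2.2.2.1, ω.2.2.1, ω.2.2.2.1))
      (fun i s => (s.2.2.1 i, s.2.2.2.1 i))
      (fun s => pK1 s.1 * pK2 s.2.1 * pT1 s.2.2.2.2.1 * pT2 s.2.2.2.2.2 *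
        (∏ i, qr (s.2.2.1 i, s.2.2.2.1 i)))
      c hc (by
        intro t s
        have := dist_equiv (α := (Fin n → X1) × K1 × K2 × (Fin n → X2) ×
            (Fin n → W) × Th1 × Th2) (β := Fin n → Yt) μ
          ⟨fun ω => ((ω.2.2.2.2.1,
            (ω.1, ω.2.1, ω.2.2.2.2.2.1, ω.2.2.2.2.2.2.1, ω.2.2.1, ω.2.2.2.1)),
              ω.2.2.2.2.2.2.2),
           fun p => (p.1.2.1, p.1.2.2.1, p.1.2.2.2.2.2.1, p.1.2.2.2.2.2.2, p.1.1,
            p.1.2.2.2.1, p.1.2.2.2.2.1, p.2), fun _ => rfl, fun _ => rfl⟩ (t, s)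
        simp only [Equiv.coe_fn_mk, Equiv.coe_fn_symm_mk] at this
        rw [this]
        simp_rw [hμ]
        rw [← Finset.mul_sum, sum_prod_eq_one
          (fun i => pch (e1 s.1 t s.2.2.2.2.1 i, e2 s.2.1 s.2.2.1 s.2.2.2.2.2 i))
          (fun i => (hpch _).2), mul_one]
        simp_rw [hqc, Finset.prod_mul_distrib]
        ring)
    have hch := chain μ (fun ω => ω.2.2.2.2.1)
      (fun ω => (ω.2.2.2.2.2.2.2,
        (ω.1, ω.2.1, ω.2.2.2.2.2.1, ω.2.2.2.2.2.2.1, ω.2.2.1, ω.2.2.2.1)))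
    have hle := Finset.sum_le_sum (s := Finset.univ) (fun (i : Fin n) _ =>
      cond_mono h0 (fun ω => ω.2.2.2.2.1 i)
      (fun ω => ((fun j : {j : Fin n // i < j} => ω.2.2.2.2.1 j.1),
        (ω.2.2.2.2.2.2.2,
        (ω.1, ω.2.1, ω.2.2.2.2.2.1, ω.2.2.2.2.2.2.1, ω.2.2.1, ω.2.2.2.1))))
      (fun ω => ((ω.1, fun j : {j : Fin n // i < j} => ω.2.2.2.2.1 j.1,
          ω.2.2.2.2.2.2.2, fun j : {j : Fin n // j ≠ i} => ω.2.2.2.2.2.2.1 j.1),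
          ((ω.2.1, fun j : {j : Fin n // i < j} => ω.2.2.2.2.2.1 j.1),
          ω.2.2.2.2.2.1 i, ω.2.2.2.2.2.2.1 i)))
      (by
        intro ω ω' h
        simp only [Prod.mk.injEq] at h ⊢
        obtain ⟨h1, h2, h3, h4, h5, h6, -, -⟩ := h
        refine ⟨⟨h3, h1, h2, ?_⟩, ⟨h4, ?_⟩, ?_, ?_⟩ <;> simp only [h5, h6]))
    have hle2 := Finset.sum_le_sum (s := Finset.univ) (fun (i : Fin n) _ =>
      cond_mono h0 (fun ω => ω.2.2.2.2.1 i)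
      (fun ω => ((ω.2.1, fun j : {j : Fin n // i < j} => ω.2.2.2.2.2.1 j.1),
          ω.2.2.2.2.2.1 i, ω.2.2.2.2.2.2.1 i))
      (fun ω => (ω.2.2.2.2.2.1 i, ω.2.2.2.2.2.2.1 i))
      (by
        intro ω ω' h
        simp only [Prod.mk.injEq] at h ⊢
        exact h.2))
    have ht : ∀ i : Fin n, CMI μ
        (fun ω => (ω.1, fun j : {j : Fin n // i < j} => ω.2.2.2.2.1 j.1,
          ω.2.2.2.2.2.2.2, fun j : {j : Fin n // j ≠ i} => ω.2.2.2.2.2.2.1 j.1))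
        (fun ω => ω.2.2.2.2.1 i)
        (fun ω => ((ω.2.1, fun j : {j : Fin n // i < j} => ω.2.2.2.2.2.1 j.1),
          ω.2.2.2.2.2.1 i, ω.2.2.2.2.2.2.1 i)) =
        (H μ (fun ω => (ω.2.2.2.2.1 i,
            ((ω.2.1, fun j : {j : Fin n // i < j} => ω.2.2.2.2.2.1 j.1),
              ω.2.2.2.2.2.1 i, ω.2.2.2.2.2.2.1 i))) -
          H μ (fun ω => ((ω.2.1, fun j : {j : Fin n // i < j} => ω.2.2.2.2.2.1 j.1),
              ω.2.2.2.2.2.1 i, ω.2.2.2.2.2.2.1 i))) -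
        (H μ (fun ω => (ω.2.2.2.2.1 i,
            ((ω.1, fun j : {j : Fin n // i < j} => ω.2.2.2.2.1 j.1,
              ω.2.2.2.2.2.2.2, fun j : {j : Fin n // j ≠ i} => ω.2.2.2.2.2.2.1 j.1),
            ((ω.2.1, fun j : {j : Fin n // i < j} => ω.2.2.2.2.2.1 j.1),
              ω.2.2.2.2.2.1 i, ω.2.2.2.2.2.2.1 i)))) -
          H μ (fun ω => ((ω.1, fun j : {j : Fin n // i < j} => ω.2.2.2.2.1 j.1,
              ω.2.2.2.2.2.2.2, fun j : {j : Fin n // j ≠ i} => ω.2.2.2.2.2.2.1 j.1),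
            ((ω.2.1, fun j : {j : Fin n // i < j} => ω.2.2.2.2.2.1 j.1),
              ω.2.2.2.2.2.1 i, ω.2.2.2.2.2.2.1 i)))) := by
      intro i
      unfold CMI
      have : H μ (fun ω => ((ω.1, fun j : {j : Fin n // i < j} => ω.2.2.2.2.1 j.1,
              ω.2.2.2.2.2.2.2, fun j : {j : Fin n // j ≠ i} => ω.2.2.2.2.2.2.1 j.1),
            ω.2.2.2.2.1 i,
            ((ω.2.1, fun j : {j : Fin n // i < j} => ω.2.2.2.2.2.1 j.1),
              ω.2.2.2.2.2.1 i, ω.2.2.2.2.2.2.1 i))) =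
          H μ (fun ω => (ω.2.2.2.2.1 i,
            ((ω.1, fun j : {j : Fin n // i < j} => ω.2.2.2.2.1 j.1,
              ω.2.2.2.2.2.2.2, fun j : {j : Fin n // j ≠ i} => ω.2.2.2.2.2.2.1 j.1),
            ((ω.2.1, fun j : {j : Fin n // i < j} => ω.2.2.2.2.2.1 j.1),
              ω.2.2.2.2.2.1 i, ω.2.2.2.2.2.2.1 i)))) := by
        apply H_congr
        intro ω ω'
        simp only [Prod.mk.injEq]
        tauto
      linarith
    rw [Finset.sum_congr rfl (fun i _ => ht i), Finset.sum_sub_distrib]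
    unfold CMI
    dsimp only at hm hch hle hle2 ⊢
    linarith

end ConverseStep2a

end SecCoord
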